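/- For every integer N ≥ 1, 4^{ω(N)} ≤ 1.34 · ψ(N); equivalently, θ₂(N) = (2^{ω(N)})²/ψ(N) ≤ 1.34. -/

import Mathlib

/-- `ψ(N) = N · ∏_{p | N} (1 + 1/p)`. -/
noncomputable def psi (N : ℕ) : ℝ := N * ∏ p ∈ N.primeFactors, (1 + 1 / (p : ℝ))

/-- For a finite set `S` of primes, `4 ^ #S ≤ 4/3 · ∏_{p ∈ S} (p + 1)`. -/
theorem four_pow_card_le_prod_add_one {S : Finset ℕ} (hS : ∀ p ∈ S, p.Prime) :
    (4 : ℝ) ^ S.card ≤ 4 / 3 * ∏ p ∈ S, ((p : ℝ) + 1) := by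
  have hcorr : ∏ p ∈ S, (if p = 2 then (4 / 3 : ℝ) else 1) ≤ 4 / 3 := by
    rw [Finset.prod_ite_eq']
    split_ifs <;> norm_num
  calc (4 : ℝ) ^ S.card
      ≤ ∏ p ∈ S, ((if p = 2 then (4 / 3 : ℝ) else 1) * ((p : ℝ) + 1)) := by
        rw [← Finset.prod_const]
        refine Finset.prod_le_prod (fun _ _ => by norm_num) fun p hp => ?_
        split_ifs with h
        · subst h; norm_num
        · have h3 : 3 ≤ p := (hS p hp).two_le.lt_of_ne' h
          have : (3 : ℝ) ≤ p := by exact_mod_cast h3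
          linarith
    _ ≤ 4 / 3 * ∏ p ∈ S, ((p : ℝ) + 1) := by
        rw [Finset.prod_mul_distrib]
        gcongr

/-- `∏_{p ∣ N} (p + 1) ≤ ψ(N)` for `N ≥ 1`. -/
theorem prod_primeFactors_add_one_le_psi {N : ℕ} (hN : 1 ≤ N) :
    ∏ p ∈ N.primeFactors, ((p : ℝ) + 1) ≤ psi N := by
  have hrad : ∏ p ∈ N.primeFactors, (p : ℝ) ≤ N := by
    rw [← Nat.cast_prod, Nat.cast_le]
    exact Nat.le_of_dvd hN (Nat.prod_primeFactors_dvd N)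
  calc ∏ p ∈ N.primeFactors, ((p : ℝ) + 1)
      = (∏ p ∈ N.primeFactors, (p : ℝ)) * ∏ p ∈ N.primeFactors, (1 + 1 / (p : ℝ)) := by
        rw [← Finset.prod_mul_distrib]
        refine Finset.prod_congr rfl fun p hp => ?_
        have : (p : ℝ) ≠ 0 := by exact_mod_cast (Nat.prime_of_mem_primeFactors hp).ne_zero
        field_simp
    _ ≤ psi N := by
        unfold psi
        gcongr

/-- For every `N ≥ 1`, `4^{ω(N)} ≤ 1.34·ψ(N)`; equivalently `θ₂(N) ≤ 1.34`. -/
theorem four_pow_omega_le_psi (N : ℕ) (hN : 1 ≤ N) :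
    (4 : ℝ) ^ N.primeFactors.card ≤ 1.34 * psi N := by
  calc (4 : ℝ) ^ N.primeFactors.card ≤ 4 / 3 * ∏ p ∈ N.primeFactors, ((p : ℝ) + 1) :=
        four_pow_card_le_prod_add_one fun _ hp => Nat.prime_of_mem_primeFactors hp
    _ ≤ 4 / 3 * psi N := by gcongr; exact prod_primeFactors_add_one_le_psi hN
    _ ≤ 1.34 * psi N := by
        have h : 0 ≤ psi N := by unfold psi; positivity
        linarith
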